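/- arXiv:1903.06594 — 2 statements merged into one kernel-verified Lean document; each statement's English description precedes it below -/
import Mathlib

section
/- Suppose the family (g_j) has qualification ν̄ ∈ (0,∞]. Then for every α > 0 and every f ∈ T^α H (i.e., f = T^α h for some h ∈ H), one has ||Σ_{j>τ} T_j f|| ≤ C ||T^{−α} f|| κ^{2(α−β)} τ^{−β} for all τ ≥ 1, where β = min{α, ν̄} and C is a constant independent of f, τ and N. Here T_j f = ∫_X ⟨f, ψ_{j,x}⟩ ψ_{j,x} dρ(x) with ψ_{j,x} = G_j(T) K_x. -/
open MeasureTheory Filter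
open scoped ENNReal

local notation "⟪" x ", " y "⟫" => @inner ℂ _ _ x y

section Diagonal

variable {ι H : Type*} [NormedAddCommGroup H] [InnerProductSpace ℂ H]

theorem HilbertBasis.hasSum_sq_norm_inner (v : HilbertBasis ι ℂ H) (x : H) :
    HasSum (fun i => ‖⟪v i, x⟫‖ ^ 2) (‖x‖ ^ 2) := by
  have h := (v.hasSum_inner_mul_inner x x).mapL Complex.reCLM
  convert h using 1
  · ext i
    rw [← inner_conj_symm x (v i), mul_comm, Complex.mul_conj, Complex.normSq_eq_norm_sq]
    rfl
  · rw [inner_self_eq_norm_sq_to_K]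
    norm_cast

theorem HilbertBasis.norm_le_mul_of_norm_inner_le (v : HilbertBasis ι ℂ H) {x y : H} {M : ℝ}
    (hM : 0 ≤ M) (h : ∀ i, ‖⟪v i, x⟫‖ ≤ M * ‖⟪v i, y⟫‖) : ‖x‖ ≤ M * ‖y‖ := by
  have hle : ‖x‖ ^ 2 ≤ M ^ 2 * ‖y‖ ^ 2 := by
    refine hasSum_le (fun i => ?_) (v.hasSum_sq_norm_inner x)
      ((v.hasSum_sq_norm_inner y).mul_left (M ^ 2))
    rw [← mul_pow]
    exact pow_le_pow_left₀ (norm_nonneg _) (h i) 2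
  rw [← mul_pow] at hle
  exact le_of_sq_le_sq hle (by positivity)

theorem HilbertBasis.inner_apply_of_diagonal (v : HilbertBasis ι ℂ H) {A : H →L[ℂ] H}
    {a : ι → ℝ} (hA : ∀ i, A (v i) = ((a i : ℝ) : ℂ) • v i) (i : ι) (x : H) :
    ⟪v i, A x⟫ = (a i : ℂ) * ⟪v i, x⟫ := by
  classical
  have hEq : (innerSL ℂ (v i)).comp A = (a i : ℂ) • innerSL ℂ (v i) := by
    refine ContinuousLinearMap.ext_on (s := Set.range v) ?_ ?_
    · rw [dense_iff_closure_eq, ← Submodule.topologicalClosure_coe, v.dense_span]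
      rfl
    · rintro _ ⟨k, rfl⟩
      have hv := orthonormal_iff_ite.mp v.orthonormal i k
      by_cases hik : i = k
      · subst hik
        simp [hA]
      · simp [hA, hv, hik]
  simpa using congrArg (fun L : H →L[ℂ] ℂ => L x) hEq

theorem HilbertBasis.inner_apply_eq_of_diagonal (v : HilbertBasis ι ℂ H) {A : H →L[ℂ] H}
    {a : ι → ℝ} (hA : ∀ i, A (v i) = ((a i : ℝ) : ℂ) • v i) (x y : H) :
    ⟪A x, y⟫ = ⟪x, A y⟫ := by
  rw [← v.tsum_inner_mul_inner (A x) y, ← v.tsum_inner_mul_inner x (A y)]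
  refine tsum_congr fun i => ?_
  rw [← inner_conj_symm (A x) (v i), v.inner_apply_of_diagonal hA, v.inner_apply_of_diagonal hA,
    map_mul, Complex.conj_ofReal, inner_conj_symm]
  ring

end Diagonal

theorem sum_diff_le_of_monotone {u : ℕ → ℝ} (hu : Monotone u) {c : ℝ} (hc : ∀ n, u n ≤ c)
    (J : ℕ) (s : Finset ℕ) (hs : ∀ j ∈ s, J ≤ j) :
    ∑ j ∈ s, (u (j + 1) - u j) ≤ c - u J := by
  obtain ⟨n, hn⟩ := s.exists_nat_subset_range
  have hsub : s ⊆ Finset.Ico J (max J n) := fun j hj =>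
    Finset.mem_Ico.mpr ⟨hs j hj, lt_max_of_lt_right (Finset.mem_range.mp (hn hj))⟩
  calc ∑ j ∈ s, (u (j + 1) - u j)
      ≤ ∑ j ∈ Finset.Ico J (max J n), (u (j + 1) - u j) :=
        Finset.sum_le_sum_of_subset_of_nonneg hsub
          fun j _ _ => sub_nonneg.mpr (hu j.le_succ)
    _ = u (max J n) - u J := Finset.sum_Ico_sub u (le_max_left J n)
    _ ≤ c - u J := sub_le_sub_right (hc _) _

theorem tsum_diff_le_of_monotone {u r : ℕ → ℝ} (hu : Monotone u) {c : ℝ} (hc : ∀ n, u n ≤ c)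
    (hr : ∀ j, r (j + 1) = u (j + 1) - u j) {τ : ℝ} (hτ : 0 ≤ τ) :
    ∑' j : {j : ℕ // τ < (j : ℝ)}, r j.1 ≤ c - u ⌊τ⌋₊ := by
  have hpred : ∀ j : {j : ℕ // τ < (j : ℝ)}, ∃ k, j.1 = k + 1 ∧ ⌊τ⌋₊ ≤ k := by
    intro j
    have hlt : ⌊τ⌋₊ < j.1 := (Nat.floor_lt hτ).mpr j.2
    exact ⟨j.1 - 1, by omega, by omega⟩
  choose p hp hpJ using hpred
  have hpinj : Function.Injective p := fun a b hab =>
    Subtype.ext (by rw [hp a, hp b, hab])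
  have hrp : ∀ j, r j.1 = u (p j + 1) - u (p j) := fun j => by rw [hp j, hr]
  refine Real.tsum_le_of_sum_le (fun j => ?_) fun s => ?_
  · change 0 ≤ r j.1
    rw [hrp]
    exact sub_nonneg.mpr (hu (Nat.le_succ _))
  · rw [Finset.sum_congr rfl fun j _ => hrp j]
    refine (Finset.sum_map s ⟨p, hpinj⟩ fun k => u (k + 1) - u k).ge.trans ?_
    refine sum_diff_le_of_monotone hu hc _ _ fun k hk => ?_
    obtain ⟨j, -, rfl⟩ := Finset.mem_map.mp hk
    exact hpJ j

theorem Real.floor_rpow_neg_le {τ b : ℝ} (hτ : 1 ≤ τ) (hb : 0 ≤ b) :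
    ((⌊τ⌋₊ : ℕ) : ℝ) ^ (-b) ≤ 2 ^ b * τ ^ (-b) := by
  have h1 : (1 : ℝ) ≤ ⌊τ⌋₊ := by exact_mod_cast (Nat.one_le_floor_iff τ).mpr hτ
  have h2 : τ / 2 ≤ ⌊τ⌋₊ := by
    have := Nat.lt_floor_add_one τ
    linarith
  calc ((⌊τ⌋₊ : ℕ) : ℝ) ^ (-b) ≤ (τ / 2) ^ (-b) :=
        Real.rpow_le_rpow_of_nonpos (by positivity) h2 (by linarith)
    _ = 2 ^ b * τ ^ (-b) := by
        rw [Real.div_rpow (by positivity) (by positivity), Real.rpow_neg (by norm_num : (0:ℝ) ≤ 2)]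
        field_simp

/-- **Approximation error.** Suppose the family `(g_j)` has qualification
`ν̄ ∈ (0,∞]`. Then for every `α > 0` there is a constant `C` (independent of `f` and `τ`)
such that for every `f ∈ T^α H` and every `τ ≥ 1`,
`‖Σ_{j>τ} T_j f‖ ≤ C ‖T^{−α} f‖ κ^{2(α−β)} τ^{−β}`, where `β = min{α, ν̄}`,
`T_j f = ∫_X ⟨f, ψ_{j,x}⟩ ψ_{j,x} dρ(x)` and `ψ_{j,x} = G_j(T) K_x`.

Encoding: `ν̄ : ℝ≥0∞` and `β = (min (ofReal α) ν̄).toReal`; the RKHS is given by the feature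
map `K : X → H`; the integral operator `T` is diagonalized by the Hilbert basis `v` with
eigenvalues `μ i ∈ [0, κ²]`; the source condition `f = T^α h` with `h ⟂ ker T` is expressed
coefficientwise, and `‖T^{−α} f‖ = ‖h‖`. -/
theorem stmt4
    (X : Type*) [TopologicalSpace X] [LocallyCompactSpace X] [SecondCountableTopology X]
    [MeasurableSpace X] [BorelSpace X]
    (ρ : Measure X) [IsProbabilityMeasure ρ]
    (H : Type*) [NormedAddCommGroup H] [InnerProductSpace ℂ H] [CompleteSpace H]
    (K : X → H) (hK : Continuous K)
    (κ : ℝ) (hκ : 0 < κ) (hKb : ∀ x, ‖K x‖ ≤ κ)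
    (ι : Type*) (v : HilbertBasis ι ℂ H) (μ : ι → ℝ)
    (hμ : ∀ i, 0 ≤ μ i ∧ μ i ≤ κ ^ 2)
    (T : H →L[ℂ] H)
    (hT : ∀ f, T f = ∫ x, ⟪K x, f⟫ • K x ∂ρ)
    (hTeig : ∀ i, T (v i) = ((μ i : ℝ) : ℂ) • v i)
    (g : ℕ → ℝ → ℝ)
    (hg_nonneg : ∀ j l, 0 ≤ l → 0 ≤ g j l)
    (hg_mono : ∀ j l, 0 ≤ l → g j l ≤ g (j + 1) l)
    (hg_lim : ∀ l ∈ Set.Ioc (0:ℝ) (κ ^ 2),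
      Tendsto (fun j : ℕ => l * g j l) atTop (nhds 1))
    (G : ℕ → ℝ → ℝ)
    (hG0 : ∀ l, G 0 l = Real.sqrt (g 0 l))
    (hGsucc : ∀ j l, G (j + 1) l = Real.sqrt (g (j + 1) l - g j l))
    (Gt : ℕ → H →L[ℂ] H)
    (hGt : ∀ j i, Gt j (v i) = ((G j (μ i) : ℝ) : ℂ) • v i)
    (νbar : ℝ≥0∞) (hνbar : 0 < νbar)
    (hqual : ∀ ν : ℝ, 0 < ν → ∃ Cν : ℝ, ∀ j : ℕ, 1 ≤ j → ∀ l ∈ Set.Ioc (0:ℝ) (κ ^ 2),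
      l ^ ν * (1 - l * g j l) ≤ Cν * (j : ℝ) ^ (-(min (ENNReal.ofReal ν) νbar).toReal))
    (α : ℝ) (hα : 0 < α) :
    ∃ C : ℝ, 0 < C ∧
      ∀ f h : H,
        (∀ i, μ i = 0 → ⟪v i, h⟫ = 0) →
        (∀ i, ⟪v i, f⟫ = ((μ i ^ α : ℝ) : ℂ) * ⟪v i, h⟫) →
        ∀ τ : ℝ, 1 ≤ τ →
          ‖∑' j : {j : ℕ // τ < (j : ℝ)},
              ∫ x, ⟪Gt j.1 (K x), f⟫ • Gt j.1 (K x) ∂ρ‖ ≤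
            C * ‖h‖ * κ ^ (2 * (α - (min (ENNReal.ofReal α) νbar).toReal)) *
              τ ^ (-(min (ENNReal.ofReal α) νbar).toReal) := by
  set b : ℝ := (min (ENNReal.ofReal α) νbar).toReal with hb_def
  have hb : 0 ≤ b := ENNReal.toReal_nonneg
  obtain ⟨Cν, hCν⟩ := hqual α hα
  have hD : 0 < κ ^ (2 * (α - b)) := Real.rpow_pos_of_pos hκ _
  set M₀ : ℝ := max Cν 1 * 2 ^ b with hM₀_def
  have hM₀ : 0 < M₀ := by positivity
  refine ⟨M₀ / κ ^ (2 * (α - b)), div_pos hM₀ hD, fun f h hker hf τ hτ => ?_⟩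
  have hτ0 : 0 < τ := by linarith
  have hM : 0 ≤ M₀ * τ ^ (-b) := by positivity
  have hterm : ∀ j, ∫ x, ⟪Gt j (K x), f⟫ • Gt j (K x) ∂ρ = Gt j (T (Gt j f)) := by
    intro j
    have hint : Integrable (fun x => ⟪K x, Gt j f⟫ • K x) ρ := by
      refine Integrable.of_bound (C := κ * ‖Gt j f‖ * κ)
        (Continuous.aestronglyMeasurable (by fun_prop)) (ae_of_all _ fun x => ?_)
      rw [norm_smul]
      have := hKb x
      gcongr
      exact (norm_inner_le_norm _ _).trans (by gcongr)
    rw [hT, ← ContinuousLinearMap.integral_comp_comm _ hint]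
    simp only [map_smul, v.inner_apply_eq_of_diagonal (hGt j)]
  have hcoef : ∀ j i, ⟪v i, Gt j (T (Gt j f))⟫ =
      ((μ i * G j (μ i) ^ 2 : ℝ) : ℂ) * ⟪v i, f⟫ := by
    intro j i
    rw [v.inner_apply_of_diagonal (hGt j), v.inner_apply_of_diagonal hTeig,
      v.inner_apply_of_diagonal (hGt j)]
    push_cast
    ring
  simp only [hterm]
  by_cases hsum : Summable fun j : {j : ℕ // τ < (j : ℝ)} => Gt j.1 (T (Gt j.1 f))
  swap
  · rw [tsum_eq_zero_of_not_summable hsum, norm_zero]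
    positivity
  calc ‖∑' j : {j : ℕ // τ < (j : ℝ)}, Gt j.1 (T (Gt j.1 f))‖ ≤ M₀ * τ ^ (-b) * ‖h‖ := by
        refine v.norm_le_mul_of_norm_inner_le hM fun i => ?_
        have hexp : ⟪v i, ∑' j : {j : ℕ // τ < (j : ℝ)}, Gt j.1 (T (Gt j.1 f))⟫ =
            ((∑' j : {j : ℕ // τ < (j : ℝ)}, μ i * G j.1 (μ i) ^ 2 : ℝ) : ℂ) * ⟪v i, f⟫ := by
          rw [← innerSL_apply_apply ℂ (v i), (innerSL ℂ (v i)).map_tsum hsum, Complex.ofReal_tsum,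
            ← tsum_mul_right]
          exact tsum_congr fun j => hcoef j.1 i
        rw [hexp]
        rcases (hμ i).1.eq_or_lt with hi | hi
        · rw [hf i, hker i hi.symm]
          simp
        have hmem : μ i ∈ Set.Ioc (0 : ℝ) (κ ^ 2) := ⟨hi, (hμ i).2⟩
        have hu : Monotone fun j => μ i * g j (μ i) := monotone_nat_of_le_succ fun j =>
          mul_le_mul_of_nonneg_left (hg_mono j _ hi.le) hi.le
        have htail : ∑' j : {j : ℕ // τ < (j : ℝ)}, μ i * G j.1 (μ i) ^ 2 ≤
            1 - μ i * g ⌊τ⌋₊ (μ i) := by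
          refine tsum_diff_le_of_monotone (r := fun j => μ i * G j (μ i) ^ 2) hu
            (hu.ge_of_tendsto (hg_lim _ hmem)) (fun j => ?_) hτ0.le
          rw [hGsucc, Real.sq_sqrt (sub_nonneg.mpr (hg_mono j _ hi.le))]
          ring
        have hnn : 0 ≤ ∑' j : {j : ℕ // τ < (j : ℝ)}, μ i * G j.1 (μ i) ^ 2 :=
          tsum_nonneg fun j => by positivity
        have hq := hCν ⌊τ⌋₊ ((Nat.one_le_floor_iff τ).mpr hτ) _ hmem
        rw [hf i, norm_mul, norm_mul, Complex.norm_real, Complex.norm_real,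
          Real.norm_of_nonneg hnn, Real.norm_of_nonneg (Real.rpow_nonneg hi.le _), ← mul_assoc]
        refine mul_le_mul_of_nonneg_right ?_ (norm_nonneg _)
        calc (∑' j : {j : ℕ // τ < (j : ℝ)}, μ i * G j.1 (μ i) ^ 2) * μ i ^ α
            ≤ (1 - μ i * g ⌊τ⌋₊ (μ i)) * μ i ^ α := by gcongr
          _ ≤ Cν * ((⌊τ⌋₊ : ℕ) : ℝ) ^ (-b) := by rwa [mul_comm]
          _ ≤ max Cν 1 * (2 ^ b * τ ^ (-b)) := by
            gcongr
            · exact le_max_left _ _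
            · exact Real.floor_rpow_neg_le hτ hb
          _ = M₀ * τ ^ (-b) := by rw [hM₀_def, mul_assoc]
    _ = M₀ / κ ^ (2 * (α - b)) * ‖h‖ * κ ^ (2 * (α - b)) * τ ^ (-b) := by
        field_simp
end

section
/- Suppose supp(ρ) = X, the family (g_j) has qualification ν̄ ∈ (0,∞], and for each j ≥ 1 the function λ ↦ λ g_j(λ) is Lipschitz continuous on [0,κ²] with Lipschitz constant at most j. Let x_1,…,x_N be independent samples drawn from ρ, let α > 0, f ∈ T^α H, and β = min{α, ν̄}. Then for every t > 0, with probability at least 1 − 2e^{−t}, || f − Σ_{j ≤ N^{1/(2β+2)}} (1/N) Σ_{i=1}^N ⟨f, ψ̂_{j,x_i}⟩ ψ̂_{j,x_i} || ≤ C ||T^{−α} f|| ( κ^{2(α−β)} + κ^{2α+2} √t ) N^{−β/(2β+2)}, where C is a constant independent of f, N and t. -/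
open MeasureTheory Filter
open scoped ENNReal

local notation "⟪" x ", " y "⟫" => @inner ℂ _ _ x y

/-- The support of a measure: the set of points all of whose open neighborhoods have
positive measure. -/
def measSupport {X : Type*} [TopologicalSpace X] [MeasurableSpace X]
    (ρ : Measure X) : Set X :=
  {x | ∀ U : Set X, IsOpen U → x ∈ U → ρ U ≠ 0}

section Hoeffding

theorem cosh_sqrt_convex {p q θ : ℝ} (hp : 0 ≤ p) (hq : 0 ≤ q) (h0 : 0 ≤ θ) (h1 : θ ≤ 1) :
    Real.cosh (√((1 - θ) * p + θ * q)) ≤ (1 - θ) * Real.cosh (√p) + θ * Real.cosh (√q) := by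
  have hy : 0 ≤ (1 - θ) * p + θ * q :=
    add_nonneg (mul_nonneg (by linarith) hp) (mul_nonneg h0 hq)
  refine hasSum_le (fun n => ?_) (Real.hasSum_cosh _)
    (((Real.hasSum_cosh (√p)).mul_left (1 - θ)).add ((Real.hasSum_cosh (√q)).mul_left θ))
  have := (convexOn_pow n).2 (Set.mem_Ici.2 hp) (Set.mem_Ici.2 hq) (by linarith : 0 ≤ 1 - θ) h0
    (by ring)
  simp only [smul_eq_mul] at this
  simp only [pow_mul, Real.sq_sqrt hp, Real.sq_sqrt hq, Real.sq_sqrt hy]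
  rw [← mul_div_assoc, ← mul_div_assoc, ← add_div]
  gcongr

variable {E : Type*} [NormedAddCommGroup E] [InnerProductSpace ℂ E]

theorem exists_cosh_norm_add_le (s : E) {c : ℝ} (hc : 0 ≤ c) :
    ∃ a : ℝ, ∀ ξ : E, ‖ξ‖ ≤ c →
      Real.cosh ‖s + ξ‖ ≤ Real.cosh ‖s‖ * Real.cosh c + a * (⟪s, ξ⟫).re := by
  rcases (norm_nonneg s).eq_or_lt with hs | hs
  · refine ⟨0, fun ξ hξ => ?_⟩
    have : s = 0 := norm_eq_zero.1 hs.symm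
    subst this
    simpa [abs_of_nonneg hc] using hξ
  rcases hc.eq_or_lt with hc' | hc'
  · refine ⟨0, fun ξ hξ => ?_⟩
    have : ξ = 0 := norm_le_zero_iff.1 (hc' ▸ hξ)
    simp [this, ← hc']
  refine ⟨Real.sinh ‖s‖ * Real.sinh c / (‖s‖ * c), fun ξ hξ => ?_⟩
  set b : ℝ := (⟪s, ξ⟫).re
  have hb : |b| ≤ ‖s‖ * c :=
    ((Complex.abs_re_le_norm _).trans (norm_inner_le_norm s ξ)).trans (by gcongr)
  obtain ⟨hb1, hb2⟩ := abs_le.1 hb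
  have hsc : 0 < ‖s‖ * c := mul_pos hs hc'
  set θ : ℝ := (1 + b / (‖s‖ * c)) / 2 with hθ
  have hbd : b / (‖s‖ * c) * (‖s‖ * c) = b := div_mul_cancel₀ _ hsc.ne'
  have hd1 : -1 ≤ b / (‖s‖ * c) := by rw [le_div_iff₀ hsc]; linarith
  have hd2 : b / (‖s‖ * c) ≤ 1 := by rw [div_le_iff₀ hsc]; linarith
  have key := cosh_sqrt_convex (sq_nonneg (‖s‖ - c)) (sq_nonneg (‖s‖ + c))
    (by linarith : 0 ≤ θ) (by linarith : θ ≤ 1)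
  have hy : (1 - θ) * (‖s‖ - c) ^ 2 + θ * (‖s‖ + c) ^ 2 = ‖s‖ ^ 2 + 2 * b + c ^ 2 := by
    rw [hθ]; linear_combination 2 * hbd
  have hn : ‖s + ξ‖ ^ 2 = ‖s‖ ^ 2 + 2 * b + ‖ξ‖ ^ 2 := @norm_add_sq ℂ _ _ _ _ s ξ
  have hle : ‖s + ξ‖ ≤ √(‖s‖ ^ 2 + 2 * b + c ^ 2) := by
    apply Real.le_sqrt_of_sq_le
    rw [hn]; gcongr
  rw [hy, Real.sqrt_sq_eq_abs, Real.sqrt_sq (by positivity), Real.cosh_abs, Real.cosh_sub,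
    Real.cosh_add] at key
  calc Real.cosh ‖s + ξ‖ ≤ Real.cosh (√(‖s‖ ^ 2 + 2 * b + c ^ 2)) := by
        rw [Real.cosh_le_cosh, abs_of_nonneg (norm_nonneg _), abs_of_nonneg (Real.sqrt_nonneg _)]
        exact hle
    _ ≤ _ := key
    _ = _ := by rw [hθ]; ring

variable {X : Type*} [MeasurableSpace X] (ρ : Measure X) [IsProbabilityMeasure ρ]

omit [InnerProductSpace ℂ E] in
theorem integrable_cosh_norm {Y : Type*} [MeasurableSpace Y] (P : Measure Y) [IsFiniteMeasure P]
    {S : Y → E} (hS : StronglyMeasurable S) {B : ℝ} (hB : ∀ y, ‖S y‖ ≤ B) :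
    Integrable (fun y => Real.cosh ‖S y‖) P := by
  refine Integrable.of_bound
    (Real.continuous_cosh.comp_stronglyMeasurable hS.norm).aestronglyMeasurable (Real.cosh B)
    (ae_of_all _ fun y => ?_)
  rw [Real.norm_eq_abs, abs_of_pos (Real.cosh_pos _), Real.cosh_le_cosh, abs_of_nonneg (norm_nonneg _)]
  exact (hB y).trans (le_abs_self B)

variable [CompleteSpace E]

theorem integral_cosh_norm_add_le {ξ : X → E} (hξ : StronglyMeasurable ξ) {c : ℝ}
    (hc : ∀ x, ‖ξ x‖ ≤ c) (hc0 : 0 ≤ c) (hmean : ∫ x, ξ x ∂ρ = 0) (s : E) :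
    ∫ x, Real.cosh ‖s + ξ x‖ ∂ρ ≤ Real.cosh ‖s‖ * Real.cosh c := by
  obtain ⟨a, ha⟩ := exists_cosh_norm_add_le s hc0
  have hint : Integrable ξ ρ :=
    Integrable.of_bound hξ.aestronglyMeasurable c (ae_of_all _ hc)
  have hinner : Integrable (fun x => ⟪s, ξ x⟫) ρ := hint.const_inner s
  have hre : Integrable (fun x => (⟪s, ξ x⟫).re) ρ := hinner.re
  have hzero : ∫ x, (⟪s, ξ x⟫).re ∂ρ = 0 := by
    have h1 : ∫ x, (⟪s, ξ x⟫).re ∂ρ = (∫ x, ⟪s, ξ x⟫ ∂ρ).re := integral_re hinner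
    rw [h1, integral_inner hint, hmean, inner_zero_right, Complex.zero_re]
  calc ∫ x, Real.cosh ‖s + ξ x‖ ∂ρ
      ≤ ∫ x, (Real.cosh ‖s‖ * Real.cosh c + a * (⟪s, ξ x⟫).re) ∂ρ := by
        refine integral_mono ?_ ((integrable_const _).add (hre.const_mul a))
          fun x => ha _ (hc x)
        exact integrable_cosh_norm ρ (stronglyMeasurable_const.add hξ) (B := ‖s‖ + c)
          fun x => (norm_add_le _ _).trans (by gcongr; exact hc x)
    _ = _ := by
        rw [integral_add (integrable_const _) (hre.const_mul a), integral_const_mul a, hzero,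
          integral_const, probReal_univ, one_smul, mul_zero, add_zero]

omit [InnerProductSpace ℂ E] [CompleteSpace E] in
theorem stronglyMeasurable_sum_eval {ξ : X → E} (hξ : StronglyMeasurable ξ) (n : ℕ) :
    StronglyMeasurable fun xs : Fin n → X => ∑ k, ξ (xs k) :=
  Finset.stronglyMeasurable_fun_sum _ fun k _ => hξ.comp_measurable (measurable_pi_apply k)

omit [InnerProductSpace ℂ E] [MeasurableSpace X] [CompleteSpace E] in
theorem norm_sum_eval_le {ξ : X → E} {c : ℝ} (hc : ∀ x, ‖ξ x‖ ≤ c) {n : ℕ} (xs : Fin n → X) :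
    ‖∑ k, ξ (xs k)‖ ≤ n * c := by
  simpa using norm_sum_le_of_le Finset.univ fun k _ => hc (xs k)

theorem integral_cosh_norm_add_sum_le {ξ : X → E} (hξ : StronglyMeasurable ξ) {c : ℝ}
    (hc : ∀ x, ‖ξ x‖ ≤ c) (hc0 : 0 ≤ c) (hmean : ∫ x, ξ x ∂ρ = 0) (n : ℕ) (s : E) :
    ∫ xs, Real.cosh ‖s + ∑ k, ξ (xs k)‖ ∂(Measure.pi fun _ : Fin n => ρ) ≤
      Real.cosh ‖s‖ * Real.cosh c ^ n := by
  induction n generalizing s with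
  | zero => simp
  | succ n ih =>
    have hmp := (measurePreserving_piFinSuccAbove (fun _ : Fin (n + 1) => ρ) 0).symm
    rw [← hmp.integral_comp']
    have hsm : StronglyMeasurable fun z : X × (Fin n → X) => s + ξ z.1 + ∑ k, ξ (z.2 k) :=
      (stronglyMeasurable_const.add (hξ.comp_measurable measurable_fst)).add
        ((stronglyMeasurable_sum_eval hξ n).comp_measurable measurable_snd)
    have hint := integrable_cosh_norm (ρ.prod (Measure.pi fun _ : Fin n => ρ)) hsm
      (B := ‖s‖ + c + n * c) fun z => (norm_add_le _ _).trans
        (add_le_add ((norm_add_le _ _).trans (by gcongr; exact hc _)) (norm_sum_eval_le hc _))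
    have heq : ∀ z : X × (Fin n → X),
        Real.cosh ‖s + ∑ k, ξ ((MeasurableEquiv.piFinSuccAbove (fun _ => X) 0).symm z k)‖ =
          Real.cosh ‖s + ξ z.1 + ∑ k, ξ (z.2 k)‖ := by
      intro z
      rw [Fin.sum_univ_succ, ← add_assoc]
      simp [MeasurableEquiv.piFinSuccAbove]
    simp only [heq]
    rw [integral_prod _ hint]
    calc _ ≤ ∫ x, Real.cosh ‖s + ξ x‖ * Real.cosh c ^ n ∂ρ := by
          refine integral_mono hint.integral_prod_left (Integrable.mul_const ?_ _)
            fun x => ih (s + ξ x)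
          exact integrable_cosh_norm ρ (stronglyMeasurable_const.add hξ) (B := ‖s‖ + c)
            fun x => (norm_add_le _ _).trans (by gcongr; exact hc x)
      _ = (∫ x, Real.cosh ‖s + ξ x‖ ∂ρ) * Real.cosh c ^ n := integral_mul_const _ _
      _ ≤ Real.cosh ‖s‖ * Real.cosh c * Real.cosh c ^ n := by
          gcongr
          exact integral_cosh_norm_add_le ρ hξ hc hc0 hmean s
      _ = _ := by ring

/-- **Hoeffding's inequality** for sums of bounded independent vectors in a Hilbert space. -/
theorem measure_norm_sum_le_ge {ξ : X → E} (hξ : StronglyMeasurable ξ) {c : ℝ}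
    (hc : ∀ x, ‖ξ x‖ ≤ c) (hc0 : 0 < c) (hmean : ∫ x, ξ x ∂ρ = 0) {n : ℕ} (hn : 0 < n)
    {t : ℝ} (ht : 0 < t) :
    ENNReal.ofReal (1 - 2 * Real.exp (-t)) ≤ (Measure.pi fun _ : Fin n => ρ)
      {xs | ‖∑ k, ξ (xs k)‖ ≤ c * √(2 * n * t)} := by
  set P := Measure.pi fun _ : Fin n => ρ
  have hn' : (0 : ℝ) < n := by exact_mod_cast hn
  set r := √(2 * n * t)
  have hr : r ^ 2 = 2 * n * t := Real.sq_sqrt (by positivity)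
  have hr0 : 0 < r := Real.sqrt_pos.2 (by positivity)
  set l : ℝ := r / (n * c) with hl
  have hl0 : 0 < l := by positivity
  have hb : ∀ x, ‖((l : ℝ) : ℂ) • ξ x‖ ≤ l * c := fun x => by
    rw [norm_smul, Complex.norm_real, Real.norm_eq_abs, abs_of_pos hl0]
    gcongr; exact hc x
  have hsm : StronglyMeasurable fun x => ((l : ℝ) : ℂ) • ξ x := hξ.const_smul _
  have hE := integral_cosh_norm_add_sum_le ρ hsm hb (by positivity)
    (by rw [integral_smul, hmean, smul_zero]) n 0
  have hint := integrable_cosh_norm P (stronglyMeasurable_sum_eval hsm n)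
    (fun xs => norm_sum_eval_le hb xs)
  simp only [zero_add, norm_zero, Real.cosh_zero, one_mul] at hE
  have hnorm : ∀ xs : Fin n → X, ‖∑ k, ((l : ℝ) : ℂ) • ξ (xs k)‖ = l * ‖∑ k, ξ (xs k)‖ :=
    fun xs => by
      rw [← Finset.smul_sum, norm_smul, Complex.norm_real, Real.norm_eq_abs, abs_of_pos hl0]
  have hmarkov := mul_meas_ge_le_integral_of_nonneg
    (ae_of_all P fun xs => (Real.cosh_pos _).le) hint (Real.cosh (l * (c * r)))
  have hmeas : MeasurableSet {xs : Fin n → X | ‖∑ k, ξ (xs k)‖ ≤ c * r} :=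
    (stronglyMeasurable_sum_eval hξ n).norm.measurable measurableSet_Iic
  have hlc : l * (c * r) = 2 * t := by
    rw [hl]; field_simp; rw [hr]; ring
  have hexp : Real.cosh (l * c) ^ n ≤ Real.exp t := by
    calc Real.cosh (l * c) ^ n ≤ Real.exp ((l * c) ^ 2 / 2) ^ n := by
          gcongr; exact Real.cosh_le_exp_half_sq _
      _ = Real.exp t := by
          rw [← Real.exp_nat_mul]; congr 1; rw [hl]; field_simp; rw [hr]; ring
  have hcosh : Real.exp (2 * t) / 2 ≤ Real.cosh (l * (c * r)) := by
    rw [hlc, Real.cosh_eq]; have := Real.exp_pos (-(2 * t)); linarith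
  have hcompl : P.real {xs : Fin n → X | ‖∑ k, ξ (xs k)‖ ≤ c * r}ᶜ ≤ 2 * Real.exp (-t) := by
    have hsub : {xs : Fin n → X | ‖∑ k, ξ (xs k)‖ ≤ c * r}ᶜ ⊆
        {xs | Real.cosh (l * (c * r)) ≤ Real.cosh ‖∑ k, ((l : ℝ) : ℂ) • ξ (xs k)‖} := by
      intro xs hxs
      simp only [Set.mem_compl_iff, Set.mem_ofPred_eq, not_le] at hxs ⊢
      rw [hnorm, Real.cosh_le_cosh, abs_of_pos (by positivity), abs_of_nonneg (by positivity)]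
      gcongr
    have h1 := (mul_le_mul_of_nonneg_left (measureReal_mono (μ := P) hsub)
      (Real.cosh_pos (l * (c * r))).le).trans (hmarkov.trans (hE.trans hexp))
    have h2 := (mul_le_mul_of_nonneg_right hcosh measureReal_nonneg).trans h1
    have h3 : Real.exp (2 * t) = Real.exp t * Real.exp t := by rw [← Real.exp_add]; ring_nf
    have h4 : Real.exp t * Real.exp (-t) = 1 := by rw [← Real.exp_add]; simp
    have h5 := Real.exp_pos t
    rw [h3] at h2
    refine le_of_mul_le_mul_left ?_ (mul_pos h5 h5)
    calc _ ≤ 2 * Real.exp t := by linarith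
      _ = _ := by linear_combination -2 * Real.exp t * h4
  rw [probReal_compl_eq_one_sub hmeas] at hcompl
  rw [← ofReal_measureReal]
  exact ENNReal.ofReal_le_ofReal (by linarith)

end Hoeffding

section HilbertBasis

variable {ι ι' H : Type*} [NormedAddCommGroup H] [InnerProductSpace ℂ H]

theorem HilbertBasis.hasSum_norm_inner_sq (u : HilbertBasis ι ℂ H) (y : H) :
    HasSum (fun k => ‖⟪u k, y⟫‖ ^ 2) (‖y‖ ^ 2) := by
  simpa [u.repr_apply_apply] using lp.hasSum_norm (p := 2) (by simp) (u.repr y)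

theorem HilbertBasis.inner_apply_of_diagonal_s8 (u : HilbertBasis ι ℂ H) {S : H →L[ℂ] H}
    {m : ι → ℝ} (hS : ∀ k, S (u k) = (m k : ℂ) • u k) (k : ι) (y : H) :
    ⟪u k, S y⟫ = m k * ⟪u k, y⟫ := by
  classical
  have h1 := ((u.hasSum_repr y).mapL S).mapL (innerSL ℂ (u k))
  have h2 : ∀ i, innerSL ℂ (u k) (S (u.repr y i • u i)) =
      if i = k then (m k : ℂ) * ⟪u k, y⟫ else 0 := fun i => by
    simp only [map_smul, hS, innerSL_apply_apply, smul_eq_mul, u.repr_apply_apply,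
      orthonormal_iff_ite.1 u.orthonormal]
    by_cases h : i = k
    · subst h; simp [mul_comm]
    · simp [h, Ne.symm h]
  simp only [h2] at h1
  exact h1.unique (hasSum_ite_eq _ _)

theorem HilbertBasis.adjoint_apply_of_diagonal [CompleteSpace H] (u : HilbertBasis ι ℂ H)
    {S : H →L[ℂ] H} {m : ι → ℝ} (hS : ∀ k, S (u k) = (m k : ℂ) • u k) (k : ι) :
    S.adjoint (u k) = (m k : ℂ) • u k := by
  refine ext_inner_right ℂ fun y => ?_
  rw [ContinuousLinearMap.adjoint_inner_left, u.inner_apply_of_diagonal_s8 hS, inner_smul_left,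
    Complex.conj_ofReal]

theorem Orthonormal.norm_sq_sum {v : ι → H} (hv : Orthonormal ℂ v) (c : ι → ℂ) (s : Finset ι) :
    ‖∑ i ∈ s, c i • v i‖ ^ 2 = ∑ i ∈ s, ‖c i‖ ^ 2 := by
  have h := hv.inner_sum c c s
  rw [inner_self_eq_norm_sq_to_K] at h
  exact Complex.ofReal_injective (by simpa [Complex.conj_mul'] using h)

/-- Functions of two diagonalizable operators differ by at most the Lipschitz constant of the
function times the difference of the operators, on each vector of an eigenbasis. -/
theorem HilbertBasis.norm_apply_sub_smul_le (u : HilbertBasis ι ℂ H) {S A : H →L[ℂ] H}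
    {m F : ι → ℝ} (hS : ∀ k, S (u k) = (m k : ℂ) • u k) (hA : ∀ k, A (u k) = (F k : ℂ) • u k)
    {a b L : ℝ} (hL : 0 ≤ L) (hF : ∀ k, |F k - b| ≤ L * |m k - a|) (y : H) :
    ‖A y - (b : ℂ) • y‖ ≤ L * ‖S y - (a : ℂ) • y‖ := by
  refine le_of_sq_le_sq ?_ (by positivity)
  rw [mul_pow]
  refine hasSum_le (fun k => ?_) (u.hasSum_norm_inner_sq _)
    ((u.hasSum_norm_inner_sq (S y - (a : ℂ) • y)).mul_left (L ^ 2))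
  rw [inner_sub_right, inner_sub_right, inner_smul_right, inner_smul_right,
    u.inner_apply_of_diagonal_s8 hS, u.inner_apply_of_diagonal_s8 hA, ← sub_mul, ← sub_mul,
    ← Complex.ofReal_sub, ← Complex.ofReal_sub, norm_mul, norm_mul, Complex.norm_real,
    Complex.norm_real, Real.norm_eq_abs, Real.norm_eq_abs, ← mul_pow, ← mul_assoc]
  gcongr
  exact hF k

theorem HilbertBasis.norm_sub_apply_le (v : HilbertBasis ι ℂ H) (A : H →L[ℂ] H) (F : ι → ℝ)
    (f h : H) {ε B M : ℝ} (hε : 0 ≤ ε) (hB : 0 ≤ B) (hM : 0 ≤ M)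
    (hr : ∀ i, ‖(1 - F i : ℂ) * ⟪v i, f⟫‖ ≤ ε * ‖⟪v i, h⟫‖)
    (hf : ∀ i, ‖⟪v i, f⟫‖ ≤ B * ‖⟪v i, h⟫‖)
    (hA : ∀ s : Finset ι, ∑ i ∈ s, ‖A (v i) - (F i : ℂ) • v i‖ ^ 2 ≤ M ^ 2) :
    ‖f - A f‖ ≤ ε * ‖h‖ + B * ‖h‖ * M := by
  have hsum : ∀ s : Finset ι, ∑ i ∈ s, ‖⟪v i, h⟫‖ ^ 2 ≤ ‖h‖ ^ 2 := fun s =>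
    v.orthonormal.sum_inner_products_le h
  have hlim := (v.hasSum_repr f).sub ((v.hasSum_repr f).mapL A)
  refine le_of_tendsto hlim.norm (Eventually.of_forall fun s => ?_)
  have hsplit : ∑ i ∈ s, (v.repr f i • v i - A (v.repr f i • v i)) =
      ∑ i ∈ s, ((1 - F i : ℂ) * ⟪v i, f⟫) • v i -
        ∑ i ∈ s, ⟪v i, f⟫ • (A (v i) - (F i : ℂ) • v i) := by
    rw [← Finset.sum_sub_distrib]
    refine Finset.sum_congr rfl fun i _ => ?_
    rw [map_smul, v.repr_apply_apply]
    module
  rw [hsplit]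
  refine (norm_sub_le _ _).trans (add_le_add ?_ ?_)
  · refine le_of_sq_le_sq ?_ (by positivity)
    rw [v.orthonormal.norm_sq_sum, mul_pow]
    calc _ ≤ ∑ i ∈ s, ε ^ 2 * ‖⟪v i, h⟫‖ ^ 2 := by
          refine Finset.sum_le_sum fun i _ => ?_
          rw [← mul_pow]
          gcongr
          exact hr i
      _ ≤ _ := by rw [← Finset.mul_sum]; gcongr; exact hsum s
  · calc _ ≤ ∑ i ∈ s, ‖⟪v i, f⟫‖ * ‖A (v i) - (F i : ℂ) • v i‖ :=
          norm_sum_le_of_le _ fun i _ => (norm_smul _ _).le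
      _ ≤ √(∑ i ∈ s, ‖⟪v i, f⟫‖ ^ 2) * √(∑ i ∈ s, ‖A (v i) - (F i : ℂ) • v i‖ ^ 2) :=
          Real.sum_mul_le_sqrt_mul_sqrt _ _ _
      _ ≤ B * ‖h‖ * M := by
          gcongr
          · refine Real.sqrt_le_iff.2 ⟨by positivity, ?_⟩
            calc _ ≤ ∑ i ∈ s, B ^ 2 * ‖⟪v i, h⟫‖ ^ 2 := by
                  refine Finset.sum_le_sum fun i _ => ?_
                  rw [← mul_pow]
                  gcongr
                  exact hf i
              _ ≤ _ := by rw [← Finset.mul_sum, mul_pow]; gcongr; exact hsum s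
          · exact Real.sqrt_le_iff.2 ⟨hM, hA s⟩

variable (v : HilbertBasis ι ℂ H)

theorem HilbertBasis.sum_norm_inner_smul_sq_le (a b : H) (s : Finset ι) :
    ∑ i ∈ s, ‖⟪a, v i⟫ • b‖ ^ 2 ≤ (‖a‖ * ‖b‖) ^ 2 := by
  simp only [norm_smul, mul_pow, ← Finset.sum_mul]
  gcongr
  simpa only [norm_inner_symm] using v.orthonormal.sum_inner_products_le a (s := s)

/-- The rank one operator `⟪a, ·⟫ • b` as a Hilbert-Schmidt operator, given by its values on a
Hilbert basis. -/
noncomputable def HilbertBasis.rankOne (a b : H) : lp (fun _ : ι => H) 2 :=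
  ⟨fun i => ⟪a, v i⟫ • b, memℓp_gen' (C := (‖a‖ * ‖b‖) ^ 2) fun s => by
    simpa using v.sum_norm_inner_smul_sq_le a b s⟩

theorem HilbertBasis.rankOne_apply (a b : H) (i : ι) : v.rankOne a b i = ⟪a, v i⟫ • b := rfl

theorem HilbertBasis.norm_rankOne_le (a b : H) : ‖v.rankOne a b‖ ≤ ‖a‖ * ‖b‖ :=
  lp.norm_le_of_forall_sum_le (by simp) (by positivity) fun s => by
    simpa [v.rankOne_apply] using v.sum_norm_inner_smul_sq_le a b s

theorem HilbertBasis.continuous_rankOne {X : Type*} [TopologicalSpace X] {K : X → H}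
    (hK : Continuous K) : Continuous fun x => v.rankOne (K x) (K x) := by
  let B : H →L⋆[ℂ] H →L[ℂ] lp (fun _ : ι => H) 2 :=
    (LinearMap.mk₂'ₛₗ (starRingEnd ℂ) (RingHom.id ℂ) v.rankOne
      (fun a a' b => lp.ext <| funext fun i => by simp [v.rankOne_apply, add_smul])
      (fun c a b => lp.ext <| funext fun i => by simp [v.rankOne_apply, mul_smul,
        smul_comm _ (starRingEnd ℂ c)])
      (fun a b b' => lp.ext <| funext fun i => by simp [v.rankOne_apply])
      (fun c a b => lp.ext <| funext fun i => by
        simp [v.rankOne_apply, smul_comm _ c])).mkContinuous₂ 1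
      (fun a b => by simpa using v.norm_rankOne_le a b)
  exact (B.continuous.comp hK).clm_apply hK

end HilbertBasis

section Empirical

variable {X ι H : Type*} [NormedAddCommGroup H] [InnerProductSpace ℂ H]

/-- With high probability, the empirical operator is close to the integral operator in
Hilbert-Schmidt norm. -/
theorem le_measure_sum_norm_empirical_sub_sq [CompleteSpace H] [TopologicalSpace X]
    [MeasurableSpace X] [SecondCountableTopology X] [OpensMeasurableSpace X] (ρ : Measure X) [IsProbabilityMeasure ρ]
    {K : X → H} (hK : Continuous K) {κ : ℝ} (hκ : 0 < κ) (hKb : ∀ x, ‖K x‖ ≤ κ)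
    (v : HilbertBasis ι ℂ H) {T : H →L[ℂ] H} (hT : ∀ f, T f = ∫ x, ⟪K x, f⟫ • K x ∂ρ)
    {N : ℕ} (hN : 1 ≤ N) {That : (Fin N → X) → H →L[ℂ] H}
    (hThat : ∀ xs f, That xs f = (N : ℂ)⁻¹ • ∑ i, ⟪K (xs i), f⟫ • K (xs i))
    {t : ℝ} (ht : 0 < t) :
    ENNReal.ofReal (1 - 2 * Real.exp (-t)) ≤ (Measure.pi fun _ : Fin N => ρ)
      {xs | ∀ s : Finset ι, ∑ i ∈ s, ‖That xs (v i) - T (v i)‖ ^ 2 ≤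
        (2 * κ ^ 2 * √(2 * N * t) / N) ^ 2} := by
  have hN' : (0 : ℝ) < N := by exact_mod_cast hN
  set Φ : X → lp (fun _ : ι => H) 2 := fun x => v.rankOne (K x) (K x)
  have hΦ : StronglyMeasurable Φ := (v.continuous_rankOne hK).stronglyMeasurable
  have hΦb : ∀ x, ‖Φ x‖ ≤ κ ^ 2 := fun x => (v.norm_rankOne_le _ _).trans (by
    rw [sq]; exact mul_le_mul (hKb x) (hKb x) (norm_nonneg _) hκ.le)
  have hint : Integrable Φ ρ :=
    Integrable.of_bound hΦ.aestronglyMeasurable (κ ^ 2) (ae_of_all _ hΦb)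
  have hmean : ‖∫ x, Φ x ∂ρ‖ ≤ κ ^ 2 := by
    simpa using norm_integral_le_of_norm_le_const (μ := ρ) (ae_of_all _ hΦb)
  have hcoord : ∀ i, (∫ x, Φ x ∂ρ : lp (fun _ : ι => H) 2) i = T (v i) := fun i => by
    rw [hT]
    exact ((lp.evalCLM ℂ (fun _ : ι => H) 2 i).integral_comp_comm hint).symm
  refine (measure_norm_sum_le_ge ρ (ξ := fun x => Φ x - ∫ y, Φ y ∂ρ)
    (hΦ.sub stronglyMeasurable_const) (c := 2 * κ ^ 2)
    (fun x => (norm_sub_le _ _).trans (by linarith [hΦb x])) (by positivity)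
    ((integral_sub hint (integrable_const _)).trans (by simp)) hN ht).trans
    (measure_mono fun xs hxs s => ?_)
  set Z : lp (fun _ : ι => H) 2 := (N : ℂ)⁻¹ • ∑ k, (Φ (xs k) - ∫ y, Φ y ∂ρ) with hZ
  have hZi : ∀ i, Z i = That xs (v i) - T (v i) := fun i => by
    have hNc : (N : ℂ) ≠ 0 := by exact_mod_cast hN'.ne'
    rw [hZ, Finset.sum_sub_distrib, smul_sub, Finset.sum_const, Finset.card_univ,
      Fintype.card_fin, ← Nat.cast_smul_eq_nsmul ℂ, inv_smul_smul₀ hNc, lp.coeFn_sub,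
      Pi.sub_apply, hcoord, lp.coeFn_smul, Pi.smul_apply, lp.coeFn_sum, Finset.sum_apply, hThat]
    rfl
  have hZn : ‖Z‖ ≤ 2 * κ ^ 2 * √(2 * N * t) / N := by
    rw [hZ, norm_smul, norm_inv, Complex.norm_natCast, inv_mul_eq_div]
    gcongr
    exact hxs
  have hle := lp.sum_rpow_le_norm_rpow (p := 2) (by simp) Z s
  simp only [ENNReal.toReal_ofNat, Real.rpow_ofNat, hZi] at hle
  exact hle.trans (by gcongr)

theorem eigenvalue_empirical_mem_Icc {K : X → H} {κ : ℝ} (hKb : ∀ x, ‖K x‖ ≤ κ)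
    {N : ℕ} (hN : 1 ≤ N) {xs : Fin N → X} {S : H →L[ℂ] H}
    (hS : ∀ f, S f = (N : ℂ)⁻¹ • ∑ i, ⟪K (xs i), f⟫ • K (xs i))
    {u : H} (hu : ‖u‖ = 1) {m : ℝ} (hm : S u = (m : ℂ) • u) : m ∈ Set.Icc 0 (κ ^ 2) := by
  have hN' : (0 : ℝ) < N := by exact_mod_cast hN
  have h : m = (N : ℝ)⁻¹ * ∑ i, ‖⟪K (xs i), u⟫‖ ^ 2 := by
    have h1 : ⟪u, S u⟫ = m := by
      rw [hm, inner_smul_right, inner_self_eq_norm_sq_to_K, hu]; simp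
    rw [hS, inner_smul_right, inner_sum] at h1
    refine Complex.ofReal_injective ?_
    rw [← h1]
    push_cast
    congr 1
    refine Finset.sum_congr rfl fun i _ => ?_
    rw [inner_smul_right, ← inner_conj_symm u, Complex.mul_conj']
  have hle : ∀ i, ‖⟪K (xs i), u⟫‖ ^ 2 ≤ κ ^ 2 := fun i => by
    gcongr
    exact (norm_inner_le_norm _ _).trans (by rw [hu, mul_one]; exact hKb _)
  constructor
  · rw [h]; positivity
  · rw [h, inv_mul_le_iff₀ hN']
    simpa using Finset.sum_le_sum fun i (_ : i ∈ Finset.univ) => hle i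

/-- The truncated wavelet frame operator acts on the empirical eigenbasis as the spectral filter
`λ ↦ λ g_J(λ)`. -/
theorem exists_frameOperator [CompleteSpace H] {g G : ℕ → ℝ → ℝ}
    (hg_nonneg : ∀ j l, 0 ≤ l → 0 ≤ g j l)
    (hg_mono : ∀ j l, 0 ≤ l → g j l ≤ g (j + 1) l)
    (hG0 : ∀ l, G 0 l = Real.sqrt (g 0 l))
    (hGsucc : ∀ j l, G (j + 1) l = Real.sqrt (g (j + 1) l - g j l))
    {K : X → H} {N : ℕ} {xs : Fin N → X} {S : H →L[ℂ] H}
    (hS : ∀ f, S f = (N : ℂ)⁻¹ • ∑ i, ⟪K (xs i), f⟫ • K (xs i))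
    (u : HilbertBasis ι ℂ H) {m : ι → ℝ} (hm : ∀ k, 0 ≤ m k)
    (hSu : ∀ k, S (u k) = (m k : ℂ) • u k) {Gop : ℕ → H →L[ℂ] H}
    (hGop : ∀ j k, Gop j (u k) = (G j (m k) : ℂ) • u k) (J : ℕ) :
    ∃ A : H →L[ℂ] H,
      (∀ y, A y = ∑ j ∈ Finset.Iic J,
        (N : ℂ)⁻¹ • ∑ i, ⟪Gop j (K (xs i)), y⟫ • Gop j (K (xs i))) ∧
      ∀ k, A (u k) = ((m k * g J (m k) : ℝ) : ℂ) • u k := by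
  refine ⟨∑ j ∈ Finset.Iic J, Gop j ∘L S ∘L (Gop j).adjoint, fun y => ?_, fun k => ?_⟩
  · simp only [_root_.sum_apply, ContinuousLinearMap.comp_apply, hS, map_smul, map_sum,
      ContinuousLinearMap.adjoint_inner_right]
  · have htel : ∑ j ∈ Finset.Iic J, G j (m k) ^ 2 = g J (m k) := by
      rw [← Nat.range_succ_eq_Iic]
      induction J with
      | zero => simp [hG0, Real.sq_sqrt (hg_nonneg _ _ (hm k))]
      | succ J ih =>
        rw [Finset.sum_range_succ, ih, hGsucc,
          Real.sq_sqrt (sub_nonneg.2 (hg_mono _ _ (hm k)))]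
        ring
    simp only [_root_.sum_apply, ContinuousLinearMap.comp_apply,
      u.adjoint_apply_of_diagonal (hGop _), map_smul, hSu, hGop, smul_smul, ← Finset.sum_smul]
    congr 1
    rw [← htel, Finset.mul_sum]
    push_cast
    exact Finset.sum_congr rfl fun j _ => by ring

end Empirical

/-- Truncating at `⌊N ^ (1 / (2β + 2))⌋` balances the approximation and sampling errors. -/
theorem floor_rpow_balance {N : ℕ} (hN : 1 ≤ N) {β : ℝ} (hβ : 0 ≤ β) :
    1 ≤ ⌊(N : ℝ) ^ (1 / (2 * β + 2))⌋₊ ∧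
    (⌊(N : ℝ) ^ (1 / (2 * β + 2))⌋₊ : ℝ) ^ (-β) ≤ 2 ^ β * (N : ℝ) ^ (-(β / (2 * β + 2))) ∧
    (⌊(N : ℝ) ^ (1 / (2 * β + 2))⌋₊ : ℝ) * (√N / N) ≤ (N : ℝ) ^ (-(β / (2 * β + 2))) := by
  have hN1 : (1 : ℝ) ≤ N := by exact_mod_cast hN
  have hN0 : (0 : ℝ) < N := by linarith
  set M := (N : ℝ) ^ (1 / (2 * β + 2)) with hM
  have hM1 : 1 ≤ M := Real.one_le_rpow hN1 (by positivity)
  have hJ1 : 1 ≤ ⌊M⌋₊ := Nat.one_le_floor_iff _ |>.2 hM1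
  have hJ1' : (1 : ℝ) ≤ ⌊M⌋₊ := by exact_mod_cast hJ1
  have hJM : M / 2 ≤ ⌊M⌋₊ := by linarith [Nat.lt_floor_add_one M]
  refine ⟨hJ1, ?_, ?_⟩
  · calc (⌊M⌋₊ : ℝ) ^ (-β) ≤ (M / 2) ^ (-β) :=
          Real.rpow_le_rpow_of_nonpos (by positivity) hJM (by linarith)
      _ = 2 ^ β * M ^ (-β) := by
          rw [Real.div_rpow (by positivity) (by positivity), Real.rpow_neg two_pos.le,
            div_inv_eq_mul, mul_comm]
      _ = _ := by
          rw [hM, ← Real.rpow_mul hN0.le]; congr 2; ring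
  · calc (⌊M⌋₊ : ℝ) * (√N / N) ≤ M * (√N / N) := by
          gcongr; exact Nat.floor_le (by positivity)
      _ = (N : ℝ) ^ (1 / (2 * β + 2) + (1 / 2 - 1)) := by
          rw [Real.rpow_add hN0, Real.rpow_sub hN0, ← Real.sqrt_eq_rpow, Real.rpow_one]
      _ = _ := by congr 1; field_simp; ring

/-- **Main theorem: consistency of Monte Carlo wavelets.** Suppose
`supp ρ = X`, the family `(g_j)` has qualification `ν̄ ∈ (0,∞]`, and for each `j ≥ 1` the
function `λ ↦ λ g_j(λ)` is Lipschitz on `[0,κ²]` with constant at most `j`. Let `α > 0`,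
`f ∈ T^α H`, `β = min{α, ν̄}`. Then there is a constant `C` (independent of `f`, `N` and `t`)
such that, for `x_1,…,x_N` independent samples from `ρ` and every `t > 0`, with probability
at least `1 − 2e^{−t}`,
`‖f − Σ_{j ≤ N^{1/(2β+2)}} (1/N) Σ_{i=1}^N ⟨f, ψ̂_{j,x_i}⟩ ψ̂_{j,x_i}‖ ≤
  C ‖T^{−α} f‖ (κ^{2(α−β)} + κ^{2α+2} √t) N^{−β/(2β+2)}`.

Encoding: `ν̄ : ℝ≥0∞`, `β = (min (ofReal α) ν̄).toReal`; the RKHS is given by the feature map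
`K : X → H`; the integral operator `T` is diagonalized by the Hilbert basis `v` with
eigenvalues `μ i ∈ [0,κ²]`; the empirical operator `T̂ = That xs` is diagonalized by `vh xs`
with eigenvalues `μh xs`, and `G_j(T̂)` is the operator `Gth j xs` acting as `G j` on these
eigenvalues, with `G_0 = √g_0`, `G_{j+1} = √(g_{j+1} − g_j)`; the empirical wavelets are
`ψ̂_{j,x_i} = G_j(T̂) K_{x_i}`; the source condition `f = T^α h` with `h ⟂ ker T` is expressed
coefficientwise, and `‖T^{−α} f‖ = ‖h‖`; samples are a point of `X^N` with law `ρ^{⊗N}`. -/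
theorem stmt8
    (X : Type*) [TopologicalSpace X] [LocallyCompactSpace X] [SecondCountableTopology X]
    [MeasurableSpace X] [BorelSpace X]
    (ρ : Measure X) [IsProbabilityMeasure ρ]
    (hsupp : measSupport ρ = Set.univ)
    (H : Type*) [NormedAddCommGroup H] [InnerProductSpace ℂ H] [CompleteSpace H]
    (K : X → H) (hK : Continuous K)
    (κ : ℝ) (hκ : 0 < κ) (hKb : ∀ x, ‖K x‖ ≤ κ)
    (g : ℕ → ℝ → ℝ)
    (hg_nonneg : ∀ j l, 0 ≤ l → 0 ≤ g j l)
    (hg_mono : ∀ j l, 0 ≤ l → g j l ≤ g (j + 1) l)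
    (hg_lim : ∀ l ∈ Set.Ioc (0:ℝ) (κ ^ 2),
      Tendsto (fun j : ℕ => l * g j l) atTop (nhds 1))
    (hg_lip : ∀ j : ℕ, 1 ≤ j → ∀ a ∈ Set.Icc (0:ℝ) (κ ^ 2), ∀ b ∈ Set.Icc (0:ℝ) (κ ^ 2),
      |a * g j a - b * g j b| ≤ (j : ℝ) * |a - b|)
    (νbar : ℝ≥0∞) (hνbar : 0 < νbar)
    (hqual : ∀ ν : ℝ, 0 < ν → ∃ Cν : ℝ, ∀ j : ℕ, 1 ≤ j → ∀ l ∈ Set.Ioc (0:ℝ) (κ ^ 2),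
      l ^ ν * (1 - l * g j l) ≤ Cν * (j : ℝ) ^ (-(min (ENNReal.ofReal ν) νbar).toReal))
    (G : ℕ → ℝ → ℝ)
    (hG0 : ∀ l, G 0 l = Real.sqrt (g 0 l))
    (hGsucc : ∀ j l, G (j + 1) l = Real.sqrt (g (j + 1) l - g j l))
    (ι : Type*) (v : HilbertBasis ι ℂ H) (μ : ι → ℝ)
    (hμ : ∀ i, 0 ≤ μ i ∧ μ i ≤ κ ^ 2)
    (T : H →L[ℂ] H)
    (hT : ∀ f, T f = ∫ x, ⟪K x, f⟫ • K x ∂ρ)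
    (hTeig : ∀ i, T (v i) = ((μ i : ℝ) : ℂ) • v i)
    (α : ℝ) (hα : 0 < α) :
    ∃ C : ℝ, 0 < C ∧
      ∀ N : ℕ, 1 ≤ N →
      ∀ That : (Fin N → X) → H →L[ℂ] H,
        (∀ xs f, That xs f = (N : ℂ)⁻¹ • ∑ i, ⟪K (xs i), f⟫ • K (xs i)) →
      ∀ (ι' : Type) (vh : (Fin N → X) → HilbertBasis ι' ℂ H)
        (μh : (Fin N → X) → ι' → ℝ),
        (∀ xs i, That xs (vh xs i) = ((μh xs i : ℝ) : ℂ) • vh xs i) →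
      ∀ Gth : ℕ → (Fin N → X) → H →L[ℂ] H,
        (∀ j xs i, Gth j xs (vh xs i) = ((G j (μh xs i) : ℝ) : ℂ) • vh xs i) →
      ∀ f h : H,
        (∀ i, μ i = 0 → ⟪v i, h⟫ = 0) →
        (∀ i, ⟪v i, f⟫ = ((μ i ^ α : ℝ) : ℂ) * ⟪v i, h⟫) →
      ∀ t : ℝ, 0 < t →
        ENNReal.ofReal (1 - 2 * Real.exp (-t)) ≤
          Measure.pi (fun _ : Fin N => ρ)
            {xs | ‖f - ∑ j ∈ Finset.Iic
                  ⌊(N : ℝ) ^ (1 / (2 * (min (ENNReal.ofReal α) νbar).toReal + 2))⌋₊,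
                (N : ℂ)⁻¹ •
                  ∑ i, ⟪Gth j xs (K (xs i)), f⟫ • Gth j xs (K (xs i))‖ ≤
              C * ‖h‖ *
                (κ ^ (2 * (α - (min (ENNReal.ofReal α) νbar).toReal)) +
                  κ ^ (2 * α + 2) * Real.sqrt t) *
                (N : ℝ) ^ (-((min (ENNReal.ofReal α) νbar).toReal /
                  (2 * (min (ENNReal.ofReal α) νbar).toReal + 2)))} := by
  have hg_mono' : ∀ l, 0 ≤ l → Monotone fun j => l * g j l := fun l hl =>
    monotone_nat_of_le_succ fun j => mul_le_mul_of_nonneg_left (hg_mono j l hl) hl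
  obtain ⟨Cα, hCα⟩ := hqual α hα
  set β := (min (ENNReal.ofReal α) νbar).toReal
  have hβ : 0 ≤ β := ENNReal.toReal_nonneg
  refine ⟨|Cα| * 2 ^ β * κ ^ (-(2 * (α - β))) + 2 * √2, by positivity, ?_⟩
  intro N hN That hThat ι' vh μh hμh Gth hGth f h hh hf t ht
  have hN0 : (0 : ℝ) < N := by exact_mod_cast hN
  refine (le_measure_sum_norm_empirical_sub_sq ρ hK hκ hKb v hT hN hThat ht).trans
    (measure_mono fun xs hxs => ?_)
  obtain ⟨hJ1, hJβ, hJN⟩ := floor_rpow_balance hN hβ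
  simp only [Set.mem_ofPred_eq] at hxs ⊢
  set J := ⌊(N : ℝ) ^ (1 / (2 * β + 2))⌋₊
  set R := (N : ℝ) ^ (-(β / (2 * β + 2)))
  have hmem := fun k => eigenvalue_empirical_mem_Icc hKb hN (hThat xs)
    ((vh xs).orthonormal.1 k) (hμh xs k)
  obtain ⟨A, hA, hAu⟩ := exists_frameOperator hg_nonneg hg_mono hG0 hGsucc (hThat xs) (vh xs)
    (fun k => (hmem k).1) (hμh xs) (fun j k => hGth j xs k) J
  rw [← hA f]
  set δ := 2 * κ ^ 2 * √(2 * N * t) / N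
  have hκα : ∀ i, μ i ^ α ≤ κ ^ (2 * α) := fun i => by
    rw [Real.rpow_mul hκ.le, Real.rpow_two]
    exact Real.rpow_le_rpow (hμ i).1 (hμ i).2 hα.le
  have hmain := v.norm_sub_apply_le A (fun i => μ i * g J (μ i)) f h
    (ε := |Cα| * (J : ℝ) ^ (-β)) (B := κ ^ (2 * α)) (M := J * δ)
    (by positivity) (by positivity) (by positivity)
    (fun i => by
      rcases (hμ i).1.eq_or_lt with h0 | h0
      · rw [hf, hh i h0.symm]; simp
      · have hr0 : 0 ≤ 1 - μ i * g J (μ i) := sub_nonneg.2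
          ((hg_mono' _ h0.le).ge_of_tendsto (hg_lim _ ⟨h0, (hμ i).2⟩) J)
        rw [hf, ← mul_assoc, norm_mul, ← Complex.ofReal_one, ← Complex.ofReal_sub,
          ← Complex.ofReal_mul, Complex.norm_real, Real.norm_eq_abs,
          abs_of_nonneg (by positivity), mul_comm (1 - _)]
        refine mul_le_mul_of_nonneg_right ((hCα J hJ1 _ ⟨h0, (hμ i).2⟩).trans ?_) (norm_nonneg _)
        gcongr
        exact le_abs_self _)
    (fun i => by
      rw [hf, norm_mul, Complex.norm_real, Real.norm_eq_abs,
        abs_of_nonneg (Real.rpow_nonneg (hμ i).1 _)]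
      gcongr
      exact hκα i)
    (fun s => by
      rw [mul_pow]
      calc _ ≤ ∑ i ∈ s, (J : ℝ) ^ 2 * ‖That xs (v i) - T (v i)‖ ^ 2 := by
            refine Finset.sum_le_sum fun i _ => ?_
            rw [← mul_pow, hTeig]
            gcongr
            exact (vh xs).norm_apply_sub_smul_le (hμh xs) hAu (Nat.cast_nonneg J)
              (fun k => hg_lip J hJ1 _ (hmem k) _ (hμ i)) (v i)
        _ ≤ _ := by rw [← Finset.mul_sum]; gcongr; exact hxs s)
  refine hmain.trans ?_
  have hδ : J * δ ≤ 2 * √2 * κ ^ 2 * √t * R := by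
    have : J * δ = 2 * √2 * κ ^ 2 * √t * (J * (√N / N)) := by
      simp only [δ]
      rw [Real.sqrt_mul (by positivity), Real.sqrt_mul (by positivity)]; ring
    rw [this]; gcongr
  have hκ2 : κ ^ (2 * α + 2) = κ ^ (2 * α) * κ ^ 2 := by
    rw [Real.rpow_add hκ, Real.rpow_two]
  have hκ3 : κ ^ (-(2 * (α - β))) * κ ^ (2 * (α - β)) = 1 := by
    rw [← Real.rpow_add hκ]; simp
  calc |Cα| * (J : ℝ) ^ (-β) * ‖h‖ + κ ^ (2 * α) * ‖h‖ * (J * δ)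
      ≤ |Cα| * (2 ^ β * R) * ‖h‖ + κ ^ (2 * α) * ‖h‖ * (2 * √2 * κ ^ 2 * √t * R) := by
        gcongr
    _ = (|Cα| * 2 ^ β * κ ^ (-(2 * (α - β)))) * ‖h‖ * κ ^ (2 * (α - β)) * R +
        2 * √2 * ‖h‖ * (κ ^ (2 * α + 2) * √t) * R := by
        rw [hκ2]; linear_combination -(|Cα| * 2 ^ β * ‖h‖ * R) * hκ3
    _ ≤ _ := by
        have h1 : 0 ≤ |Cα| * 2 ^ β * κ ^ (-(2 * (α - β))) * ‖h‖ * (κ ^ (2 * α + 2) * √t) * R := by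
          positivity
        have h2 : 0 ≤ 2 * √2 * ‖h‖ * κ ^ (2 * (α - β)) * R := by positivity
        linarith
end
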